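/- arXiv:1306.3674 — 2 statements merged into one kernel-verified Lean document; each statement's English description precedes it below -/
import Mathlib

section
/- Let 0<q<1, let n≥1 be an integer, let 1≤i≤n, and let t≥1 be an integer. If π is a random permutation distributed according to the (n,q)-Mallows measure, then P(|π(i) − i| ≥ t) ≤ 2·q^t. -/
open Finset

/-- Number of inversions of a permutation of `Fin n`. -/
def mallowsInv {n : ℕ} (π : Equiv.Perm (Fin n)) : ℕ :=
  (Finset.univ.filter (fun p : Fin n × Fin n => p.1 < p.2 ∧ π p.2 < π p.1)).card

/-- The `(n,q)`-Mallows probability mass function on `S_n`. -/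
noncomputable def mallowsPMF (n : ℕ) (q : ℝ) (π : Equiv.Perm (Fin n)) : ℝ :=
  q ^ mallowsInv π / ∑ σ : Equiv.Perm (Fin n), q ^ mallowsInv σ

/-- Probability of an event under the `(n,q)`-Mallows measure. -/
noncomputable def mallowsProb (n : ℕ) (q : ℝ) (A : Set (Equiv.Perm (Fin n))) : ℝ :=
  ∑ π : Equiv.Perm (Fin n), A.indicator (mallowsPMF n q) π

/-- Expectation of a function under the `(n,q)`-Mallows measure. -/
noncomputable def mallowsExp (n : ℕ) (q : ℝ) (f : Equiv.Perm (Fin n) → ℝ) : ℝ :=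
  ∑ π : Equiv.Perm (Fin n), mallowsPMF n q π * f π

/-- Length of the longest increasing subsequence of a permutation of `Fin n`. -/
noncomputable def LIS {n : ℕ} (π : Equiv.Perm (Fin n)) : ℕ :=
  sSup {m | ∃ f : Fin m → Fin n, StrictMono f ∧ StrictMono (fun j => π (f j))}

/-- Length of the longest decreasing subsequence of a permutation of `Fin n`. -/
noncomputable def LDS {n : ℕ} (π : Equiv.Perm (Fin n)) : ℕ :=
  sSup {m | ∃ f : Fin m → Fin n, StrictMono f ∧ StrictAnti (fun j => π (f j))}

/-- The entry of the Lehmer code of `π` at position `i`: the number of later positions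
carrying a smaller value. -/
def lehmerCode {n : ℕ} (π : Equiv.Perm (Fin n)) (i : Fin n) : ℕ :=
  (Finset.univ.filter (fun j : Fin n => i < j ∧ π j < π i)).card

theorem mallowsInv_eq_sum_lehmerCode {n : ℕ} (π : Equiv.Perm (Fin n)) :
    mallowsInv π = ∑ i, lehmerCode π i := by
  simp only [mallowsInv, lehmerCode, Finset.card_filter]
  rw [Fintype.sum_prod_type]

/-- `j` carries the largest value below `π i` among the positions after `i`. -/
def IsCodePred {n : ℕ} (π : Equiv.Perm (Fin n)) (i j : Fin n) : Prop :=
  i < j ∧ π j < π i ∧ ∀ k, i < k → π k < π i → π k ≤ π j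

theorem exists_isCodePred {n : ℕ} {π : Equiv.Perm (Fin n)} {i : Fin n}
    (h : 0 < lehmerCode π i) : ∃ j, IsCodePred π i j := by
  obtain ⟨j, hj, hmax⟩ := Finset.exists_max_image _ π (Finset.card_pos.mp h)
  simp only [Finset.mem_filter, Finset.mem_univ, true_and] at hj hmax
  exact ⟨j, hj.1, hj.2, fun k hk hk' => hmax k ⟨hk, hk'⟩⟩

theorem IsCodePred.lehmerCode_mul_swap_self {n : ℕ} {π : Equiv.Perm (Fin n)} {i j : Fin n}
    (h : IsCodePred π i j) :
    lehmerCode (π * Equiv.swap i j) i + 1 = lehmerCode π i := by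
  obtain ⟨hij, hlt, hmax⟩ := h
  have hmem : j ∈ Finset.univ.filter (fun k : Fin n => i < k ∧ π k < π i) := by
    simp [hij, hlt]
  rw [lehmerCode, lehmerCode, ← Finset.card_erase_add_one hmem]
  congr 2
  ext k
  simp only [Finset.mem_filter, Finset.mem_univ, true_and, Finset.mem_erase,
    Equiv.Perm.mul_apply, Equiv.swap_apply_left]
  rcases eq_or_ne k j with rfl | hkj
  · simpa using fun _ => hlt.le
  constructor
  · rintro ⟨hik, hk⟩
    rw [Equiv.swap_apply_of_ne_of_ne hik.ne' hkj] at hk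
    exact ⟨hkj, hik, hk.trans hlt⟩
  · rintro ⟨-, hik, hk⟩
    rw [Equiv.swap_apply_of_ne_of_ne hik.ne' hkj]
    exact ⟨hik, (hmax k hik hk).lt_of_ne (π.injective.ne hkj)⟩

theorem IsCodePred.lehmerCode_mul_swap_of_ne {n : ℕ} {π : Equiv.Perm (Fin n)} {i j k : Fin n}
    (h : IsCodePred π i j) (hk : k ≠ i) :
    lehmerCode (π * Equiv.swap i j) k = lehmerCode π k := by
  obtain ⟨hij, hlt, hmax⟩ := h
  rcases hk.lt_or_gt with hki | hik
  · refine Finset.card_equiv (Equiv.swap i j) fun l => ?_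
    simp only [Finset.mem_filter, Finset.mem_univ, true_and, Equiv.Perm.mul_apply,
      Equiv.swap_apply_of_ne_of_ne hki.ne (hki.trans hij).ne]
    refine and_congr_left fun _ => ?_
    rw [Equiv.swap_apply_def]
    grind
  · refine congrArg Finset.card (Finset.filter_congr fun l _ => and_congr_right fun hkl => ?_)
    rw [Equiv.Perm.mul_apply, Equiv.Perm.mul_apply]
    have hil := hik.trans hkl
    have inj := π.injective
    have h1 := hmax k hik
    have h2 := hmax l hil
    have h3 : π k = π i → k = i := fun h => inj h
    have h4 : π l = π i → l = i := fun h => inj h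
    have h5 : π k = π j → k = j := fun h => inj h
    have h6 : π l = π j → l = j := fun h => inj h
    rw [Equiv.swap_apply_def, Equiv.swap_apply_def]
    grind

theorem IsCodePred.mallowsInv_mul_swap {n : ℕ} {π : Equiv.Perm (Fin n)} {i j : Fin n}
    (h : IsCodePred π i j) : mallowsInv (π * Equiv.swap i j) + 1 = mallowsInv π := by
  rw [mallowsInv_eq_sum_lehmerCode, mallowsInv_eq_sum_lehmerCode,
    ← Finset.add_sum_erase _ _ (Finset.mem_univ i),
    ← Finset.add_sum_erase _ (lehmerCode π) (Finset.mem_univ i),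
    ← h.lehmerCode_mul_swap_self,
    Finset.sum_congr rfl fun k hk => h.lehmerCode_mul_swap_of_ne (Finset.ne_of_mem_erase hk)]
  ring

theorem IsCodePred.apply_le_of_mul_swap_eq {n : ℕ} {π ρ : Equiv.Perm (Fin n)} {i j k : Fin n}
    (hπ : IsCodePred π i j) (hρ : IsCodePred ρ i k)
    (h : π * Equiv.swap i j = ρ * Equiv.swap i k) : π i ≤ ρ i := by
  have hi : π j = ρ k := by simpa using congrArg (· i) h
  have hk : π (Equiv.swap i j k) = ρ i := by simpa using congrArg (· k) h
  rcases eq_or_ne k j with rfl | hkj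
  · simp at hk
    exact hk.le
  rw [Equiv.swap_apply_of_ne_of_ne hρ.1.ne' hkj] at hk
  by_contra! hlt
  have := hπ.2.2 k hρ.1 (hk ▸ hlt)
  rw [hk, hi] at this
  exact this.not_gt hρ.2.1

theorem IsCodePred.eq_of_mul_swap_eq {n : ℕ} {π ρ : Equiv.Perm (Fin n)} {i j k : Fin n}
    (hπ : IsCodePred π i j) (hρ : IsCodePred ρ i k)
    (h : π * Equiv.swap i j = ρ * Equiv.swap i k) : π = ρ := by
  have hi : π i = ρ i :=
    (hπ.apply_le_of_mul_swap_eq hρ h).antisymm (hρ.apply_le_of_mul_swap_eq hπ h.symm)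
  have hjk : j = k := (π * Equiv.swap i j).injective <| by
    conv_rhs => rw [h]
    simpa using hi
  subst hjk
  exact mul_right_cancel h

theorem sum_pow_mallowsInv_le_of_lehmerCode {n : ℕ} {q : ℝ} (hq : 0 ≤ q) (i : Fin n) (t : ℕ) :
    ∑ π : Equiv.Perm (Fin n) with t ≤ lehmerCode π i, q ^ mallowsInv π ≤
      q ^ t * ∑ π : Equiv.Perm (Fin n), q ^ mallowsInv π := by
  classical
  induction t with
  | zero => simp
  | succ t ih =>
    have : Nonempty (Fin n) := ⟨i⟩
    choose! j hj using fun π : Equiv.Perm (Fin n) => exists_isCodePred (π := π) (i := i)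
    have hpred : ∀ π ∈ (univ : Finset (Equiv.Perm (Fin n))).filter
        (fun π => t + 1 ≤ lehmerCode π i), IsCodePred π i (j π) := fun π hπ =>
      hj π (by simp at hπ; omega)
    rw [pow_succ', mul_assoc]
    refine le_trans ?_ (mul_le_mul_of_nonneg_left ih hq)
    rw [Finset.sum_congr rfl fun π hπ => by
      rw [← (hpred π hπ).mallowsInv_mul_swap, pow_succ'], ← Finset.mul_sum]
    refine mul_le_mul_of_nonneg_left ?_ hq
    rw [← Finset.sum_image (g := fun π => π * Equiv.swap i (j π))
      (f := fun π => q ^ mallowsInv π)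
      fun π hπ ρ hρ h => (hpred π hπ).eq_of_mul_swap_eq (hpred ρ hρ) h]
    refine Finset.sum_le_sum_of_subset_of_nonneg ?_ fun _ _ _ => by positivity
    intro σ hσ
    obtain ⟨π, hπ, rfl⟩ := Finset.mem_image.mp hσ
    have h := (hpred π hπ).lehmerCode_mul_swap_self
    simp only [Finset.mem_filter, Finset.mem_univ, true_and] at hπ ⊢
    omega

theorem apply_le_add_lehmerCode {n : ℕ} (π : Equiv.Perm (Fin n)) (i : Fin n) :
    (π i : ℕ) ≤ i + lehmerCode π i := by
  have hcard : (Finset.univ.filter fun j => π j < π i).card = π i := by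
    rw [← Fin.card_Iio (π i)]
    exact Finset.card_equiv π (by simp)
  have hsub : (Finset.univ.filter fun j => π j < π i) ⊆
      Finset.Iio i ∪ Finset.univ.filter (fun j : Fin n => i < j ∧ π j < π i) := by
    intro j hj
    simp only [Finset.mem_filter, Finset.mem_univ, true_and, Finset.mem_union,
      Finset.mem_Iio] at hj ⊢
    rcases lt_trichotomy j i with h | rfl | h
    · exact .inl h
    · exact absurd hj (lt_irrefl _)
    · exact .inr ⟨h, hj⟩
  have := (Finset.card_le_card hsub).trans (Finset.card_union_le _ _)
  rwa [hcard, Fin.card_Iio] at this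

theorem mallowsInv_revPerm_conj {n : ℕ} (π : Equiv.Perm (Fin n)) :
    mallowsInv (Fin.revPerm.permCongr π) = mallowsInv π := by
  refine Finset.card_equiv ((Equiv.prodComm _ _).trans (Fin.revPerm.prodCongr Fin.revPerm))
    fun p => ?_
  simp

theorem sum_pow_mallowsInv_le_of_add_le_apply {n : ℕ} {q : ℝ} (hq : 0 ≤ q) (i : Fin n) (t : ℕ) :
    ∑ π : Equiv.Perm (Fin n) with i + t ≤ (π i : ℕ), q ^ mallowsInv π ≤
      q ^ t * ∑ π : Equiv.Perm (Fin n), q ^ mallowsInv π := by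
  refine le_trans (Finset.sum_le_sum_of_subset_of_nonneg ?_ fun _ _ _ => by positivity)
    (sum_pow_mallowsInv_le_of_lehmerCode hq i t)
  intro π hπ
  have := apply_le_add_lehmerCode π i
  simp only [Finset.mem_filter, Finset.mem_univ, true_and] at hπ ⊢
  omega

theorem sum_pow_mallowsInv_le_of_apply_add_le {n : ℕ} {q : ℝ} (hq : 0 ≤ q) (i : Fin n) (t : ℕ) :
    ∑ π : Equiv.Perm (Fin n) with π i + t ≤ (i : ℕ), q ^ mallowsInv π ≤
      q ^ t * ∑ π : Equiv.Perm (Fin n), q ^ mallowsInv π := by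
  refine le_of_eq_of_le ?_ (sum_pow_mallowsInv_le_of_add_le_apply hq i.rev t)
  refine Finset.sum_equiv Fin.revPerm.permCongr (fun π => ?_)
    fun π _ => by rw [mallowsInv_revPerm_conj]
  simp only [Finset.mem_filter, Finset.mem_univ, true_and, Equiv.permCongr_apply,
    Fin.revPerm_symm, Fin.revPerm_apply, Fin.rev_rev, Fin.val_rev]
  omega

/-- For `0<q<1`, `n≥1`, `1≤i≤n` and integer `t≥1`, if `π ~ μ_{n,q}` then
`P(|π(i) − i| ≥ t) ≤ 2 q^t`. -/
theorem mallows_displacement_tail_upper (n : ℕ) (hn : 1 ≤ n) (q : ℝ)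
    (hq0 : 0 < q) (hq1 : q < 1) (i : Fin n) (t : ℕ) (ht : 1 ≤ t) :
    mallowsProb n q {π | (t : ℤ) ≤ |(π i : ℤ) - (i : ℤ)|} ≤ 2 * q ^ t := by
  classical
  have hZ : 0 < ∑ σ : Equiv.Perm (Fin n), q ^ mallowsInv σ :=
    Finset.sum_pos (fun _ _ => by positivity) Finset.univ_nonempty
  simp only [mallowsProb, Set.indicator_apply, Set.mem_ofPred_eq, mallowsPMF]
  rw [← Finset.sum_filter, ← Finset.sum_div, div_le_iff₀ hZ, mul_assoc, two_mul]
  refine le_trans ?_ (add_le_add (sum_pow_mallowsInv_le_of_add_le_apply hq0.le i t)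
    (sum_pow_mallowsInv_le_of_apply_add_le hq0.le i t))
  rw [← Finset.sum_union_inter]
  refine le_add_of_le_of_nonneg (Finset.sum_le_sum_of_subset_of_nonneg ?_
    fun _ _ _ => by positivity) (Finset.sum_nonneg fun _ _ => by positivity)
  intro π hπ
  simp only [Finset.mem_filter, Finset.mem_univ, true_and, Finset.mem_union, le_abs] at hπ ⊢
  omega
end

section
/- There exists an absolute constant c>0 such that for all 0<q<1, all integers n≥1 and all 1≤i≤n, if π is distributed according to the (n,q)-Mallows measure then c·min(q/(1−q), n−1) ≤ E|π(i) − i| ≤ min(2q/(1−q), n−1). -/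
open Finset

/-- The number of positions after `i` that carry a smaller value than position `i`. -/
def rightInv {n : ℕ} (i : Fin n) (π : Equiv.Perm (Fin n)) : ℕ :=
  (Finset.univ.filter (fun j : Fin n => i < j ∧ π j < π i)).card

/-- The number of positions before `i` that carry a larger value than position `i`. -/
def leftInv {n : ℕ} (i : Fin n) (π : Equiv.Perm (Fin n)) : ℕ :=
  (Finset.univ.filter (fun j : Fin n => j < i ∧ π i < π j)).card

/-- Undoing an inversion by a transposition of positions lowers the number of inversions. -/
lemma mallowsInv_mul_swap_lt {n : ℕ} (π : Equiv.Perm (Fin n)) {i j : Fin n} (hij : i < j)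
    (h : π j < π i) : mallowsInv (π * Equiv.swap i j) + 1 ≤ mallowsInv π := by
  classical
  set s := Equiv.swap i j with hs
  have hsi : s i = j := Equiv.swap_apply_left i j
  have hsj : s j = i := Equiv.swap_apply_right i j
  have hss : ∀ x, s (s x) = x := fun x => Equiv.swap_apply_self i j x
  have hso : ∀ x, x ≠ i → x ≠ j → s x = x := fun x h1 h2 => Equiv.swap_apply_of_ne_of_ne h1 h2
  have hmem : (i, j) ∈ Finset.univ.filter
      (fun p : Fin n × Fin n => p.1 < p.2 ∧ π p.2 < π p.1) := by simp [hij, h]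
  unfold mallowsInv
  rw [← Finset.card_erase_add_one hmem, Nat.add_le_add_iff_right]
  refine Finset.card_le_card_of_injOn
    (fun p => if s p.1 < s p.2 then (s p.1, s p.2) else p) ?_ ?_
  · intro x hab
    obtain ⟨a, b⟩ := x
    obtain ⟨h1, h2⟩ : a < b ∧ π (s b) < π (s a) := (Finset.mem_filter.mp hab).2
    simp only [Finset.coe_erase, Finset.coe_filter, Finset.mem_univ, true_and]
    split_ifs with hc
    · refine ⟨⟨hc, h2⟩, ?_⟩
      intro he
      simp only [Set.mem_singleton_iff, Prod.mk.injEq] at he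
      have ha : a = j := by rw [← hss a, he.1, hsi]
      have hb : b = i := by rw [← hss b, he.2, hsj]
      subst ha hb
      exact absurd h1 (not_lt.mpr hij.le)
    · have hne : ¬ (a = i ∧ b = j) := by
        rintro ⟨rfl, rfl⟩
        rw [hsi, hsj] at h2
        exact absurd h2 (not_lt.mpr h.le)
      refine ⟨⟨h1, ?_⟩, fun he => hne (by simpa using he)⟩
      simp only
      by_cases ha : a = i
      · subst ha
        have hb : b ≠ j := fun hb => hne ⟨rfl, hb⟩
        rw [hsi, hso b h1.ne' hb] at h2
        exact h2.trans h
      · by_cases hb : b = j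
        · subst hb
          rw [hsj, hso a ha h1.ne] at h2
          exact h.trans h2
        · by_cases ha' : a = j
          · subst ha'
            exact absurd (by rw [hsj, hso b (hij.trans h1).ne' hb]; exact hij.trans h1) hc
          · by_cases hb' : b = i
            · subst hb'
              exact absurd (by rw [hsi, hso a ha ha']; exact h1.trans hij) hc
            · exact absurd (by rwa [hso a ha ha', hso b hb' hb]) hc
  · rintro ⟨a, b⟩ hab ⟨c, d⟩ hcd he
    simp only [Finset.coe_filter, Finset.mem_univ, true_and, Set.mem_ofPred_eq] at hab hcd
    simp only at he
    split_ifs at he with h1 h2 h2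
    · simp only [Prod.mk.injEq, EmbeddingLike.apply_eq_iff_eq] at he
      simp [he.1, he.2]
    · simp only [Prod.mk.injEq] at he
      rw [← he.1, ← he.2, hss, hss] at h2
      exact absurd hab.1 h2
    · simp only [Prod.mk.injEq] at he
      rw [he.1, he.2, hss, hss] at h1
      exact absurd hcd.1 h1
    · exact he

/-- Exchanging two adjacent values creates at most one inversion. -/
lemma mallowsInv_swap_mul_le {n : ℕ} (π : Equiv.Perm (Fin n)) {k l : Fin n}
    (hkl : (l : ℕ) = k + 1) : mallowsInv (Equiv.swap k l * π) ≤ mallowsInv π + 1 := by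
  classical
  unfold mallowsInv
  refine le_trans (Finset.card_le_card (t := insert (π.symm k, π.symm l) (Finset.univ.filter
    (fun p : Fin n × Fin n => p.1 < p.2 ∧ π p.2 < π p.1))) ?_) (Finset.card_insert_le _ _)
  intro x hab
  obtain ⟨a, b⟩ := x
  obtain ⟨h1, h2⟩ : a < b ∧ Equiv.swap k l (π b) < Equiv.swap k l (π a) :=
    (Finset.mem_filter.mp hab).2
  simp only [Finset.mem_filter, Finset.mem_univ, true_and, Finset.mem_insert, Prod.mk.injEq,
    Equiv.eq_symm_apply]
  have hne : π a ≠ π b := fun h => h1.ne (π.injective h)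
  generalize π a = x at *
  generalize π b = y at *
  simp only [Equiv.swap_apply_def] at h2
  split_ifs at h2 <;> simp only [Fin.ext_iff, Fin.lt_def] at * <;> omega

/-- Conjugation by the order reversal of `Fin n`. -/
def revConj (n : ℕ) : Equiv.Perm (Fin n) ≃ Equiv.Perm (Fin n) :=
  Fin.revPerm.permCongr

lemma revConj_apply {n : ℕ} (π : Equiv.Perm (Fin n)) (x : Fin n) :
    revConj n π x = (π x.rev).rev := by
  simp [revConj]

lemma mallowsInv_revConj {n : ℕ} (π : Equiv.Perm (Fin n)) :
    mallowsInv (revConj n π) = mallowsInv π := by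
  unfold mallowsInv
  refine Finset.card_nbij' (fun p => (p.2.rev, p.1.rev)) (fun p => (p.2.rev, p.1.rev))
    ?_ ?_ ?_ ?_
  · rintro ⟨a, b⟩ h
    simpa [revConj_apply] using h
  · rintro ⟨a, b⟩ h
    simpa [revConj_apply] using h
  · rintro ⟨a, b⟩ _
    simp
  · rintro ⟨a, b⟩ _
    simp

lemma rightInv_revConj {n : ℕ} (i : Fin n) (π : Equiv.Perm (Fin n)) :
    rightInv i.rev (revConj n π) = leftInv i π := by
  unfold rightInv leftInv
  refine Finset.card_nbij' Fin.rev Fin.rev ?_ ?_ ?_ ?_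
  · intro a h
    simp only [Finset.coe_filter, Finset.mem_univ, true_and, Set.mem_ofPred_eq,
      revConj_apply, Fin.rev_rev, Fin.rev_lt_rev] at h ⊢
    exact ⟨Fin.rev_lt_iff.mp h.1, h.2⟩
  · intro a h
    simpa [revConj_apply] using h
  · intro a _
    simp
  · intro a _
    simp

/-- A point is displaced by at most the number of inversions it takes part in. -/
lemma abs_displacement_le {n : ℕ} (i : Fin n) (π : Equiv.Perm (Fin n)) :
    |((π i : ℕ) : ℝ) - ((i : ℕ) : ℝ)| ≤ rightInv i π + leftInv i π := by
  classical
  set c := (Finset.univ.filter (fun j : Fin n => j < i ∧ π j < π i)).card with hc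
  have h1 : (π i : ℕ) = c + rightInv i π := by
    have h : (Finset.univ.filter (fun j : Fin n => π j < π i)).card = (π i : ℕ) := by
      rw [← Fin.card_Iio (π i)]
      refine Finset.card_nbij' π π.symm ?_ ?_ ?_ ?_ <;> intro a ha
      · simpa using ha
      · simpa using ha
      · simp
      · simp
    rw [← h, hc, rightInv, ← Finset.card_union_of_disjoint]
    · congr 1
      ext j
      simp only [Finset.mem_filter, Finset.mem_univ, true_and, Finset.mem_union]
      constructor
      · intro hj
        have : j ≠ i := fun e => by subst e; exact lt_irrefl _ hj
        rcases lt_or_gt_of_ne this with h | h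
        · exact Or.inl ⟨h, hj⟩
        · exact Or.inr ⟨h, hj⟩
      · rintro (h | h) <;> exact h.2
    · rw [Finset.disjoint_filter]
      intro j _ h1 h2
      exact lt_asymm h1.1 h2.1
  have h2 : (i : ℕ) = c + leftInv i π := by
    have h : (Finset.univ.filter (fun j : Fin n => j < i)).card = (i : ℕ) := by
      rw [Finset.filter_gt_eq_Iio, Fin.card_Iio]
    rw [← h, hc, leftInv, ← Finset.card_union_of_disjoint]
    · congr 1
      ext j
      simp only [Finset.mem_filter, Finset.mem_univ, true_and, Finset.mem_union]
      constructor
      · intro hj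
        rcases lt_or_gt_of_ne (fun e => hj.ne (π.injective e) : π j ≠ π i) with h | h
        · exact Or.inl ⟨hj, h⟩
        · exact Or.inr ⟨hj, h⟩
      · rintro (h | h) <;> exact h.1
    · rw [Finset.disjoint_filter]
      intro j _ h1 h2
      exact lt_asymm h1.2 h2.2
  have h1' : ((π i : ℕ) : ℝ) = c + rightInv i π := by exact_mod_cast h1
  have h2' : ((i : ℕ) : ℝ) = c + leftInv i π := by exact_mod_cast h2
  have hA : (0 : ℝ) ≤ rightInv i π := Nat.cast_nonneg _
  have hB : (0 : ℝ) ≤ leftInv i π := Nat.cast_nonneg _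
  rw [h1', h2', abs_le]
  constructor <;> linarith

lemma sum_mallowsWeight_pos (n : ℕ) {q : ℝ} (hq : 0 < q) :
    0 < ∑ σ : Equiv.Perm (Fin n), q ^ mallowsInv σ :=
  Finset.sum_pos (fun _ _ => pow_pos hq _) Finset.univ_nonempty

lemma mallowsPMF_nonneg (n : ℕ) {q : ℝ} (hq : 0 < q) (π : Equiv.Perm (Fin n)) :
    0 ≤ mallowsPMF n q π :=
  div_nonneg (pow_pos hq _).le (sum_mallowsWeight_pos n hq).le

lemma sum_mallowsPMF (n : ℕ) {q : ℝ} (hq : 0 < q) :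
    ∑ π : Equiv.Perm (Fin n), mallowsPMF n q π = 1 := by
  unfold mallowsPMF
  rw [← Finset.sum_div, div_self (sum_mallowsWeight_pos n hq).ne']

lemma mul_mallowsPMF_le {n : ℕ} {q : ℝ} (hq : 0 < q) (hq1 : q ≤ 1) {π σ : Equiv.Perm (Fin n)}
    (h : mallowsInv σ ≤ mallowsInv π + 1) : q * mallowsPMF n q π ≤ mallowsPMF n q σ := by
  unfold mallowsPMF
  rw [← mul_div_assoc, ← pow_succ']
  exact div_le_div_of_nonneg_right (pow_le_pow_of_le_one hq.le hq1 h)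
    (sum_mallowsWeight_pos n hq).le

lemma mallowsPMF_le_mul {n : ℕ} {q : ℝ} (hq : 0 < q) (hq1 : q ≤ 1) {π σ : Equiv.Perm (Fin n)}
    (h : mallowsInv σ + 1 ≤ mallowsInv π) : mallowsPMF n q π ≤ q * mallowsPMF n q σ := by
  unfold mallowsPMF
  rw [← mul_div_assoc, ← pow_succ']
  exact div_le_div_of_nonneg_right (pow_le_pow_of_le_one hq.le hq1 h)
    (sum_mallowsWeight_pos n hq).le

/-- If `i` has a smaller value to its right, the position carrying the largest such value. -/
lemma exists_max_rightInv {n : ℕ} (i : Fin n) (π : Equiv.Perm (Fin n)) (h : rightInv i π ≠ 0) :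
    ∃ j, i < j ∧ π j < π i ∧ ∀ k, i < k → π k < π i → π k ≤ π j := by
  obtain ⟨j, hj, hmax⟩ := Finset.exists_max_image
    (Finset.univ.filter (fun j : Fin n => i < j ∧ π j < π i)) π
    (Finset.card_pos.mp (Nat.pos_of_ne_zero h))
  simp only [Finset.mem_filter, Finset.mem_univ, true_and] at hj hmax
  exact ⟨j, hj.1, hj.2, fun k h1 h2 => hmax k ⟨h1, h2⟩⟩

/-- The rank of the value at `i` among the values to its right has expectation at most that of
a geometric variable. -/
lemma mallowsExp_rightInv_le {n : ℕ} {q : ℝ} (hq : 0 < q) (hq1 : q < 1) (i : Fin n) :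
    mallowsExp n q (fun π => (rightInv i π : ℝ)) ≤ q / (1 - q) := by
  classical
  set E := mallowsExp n q (fun π => (rightInv i π : ℝ)) with hE
  suffices h : E ≤ q * (E + 1) by
    rw [le_div_iff₀ (by linarith)]; linarith
  set S := Finset.univ.filter (fun π : Equiv.Perm (Fin n) => rightInv i π ≠ 0) with hS
  have hex : ∀ π : Equiv.Perm (Fin n), ∃ j, rightInv i π ≠ 0 →
      i < j ∧ π j < π i ∧ ∀ k, i < k → π k < π i → π k ≤ π j := by
    intro π
    by_cases h : rightInv i π ≠ 0
    · obtain ⟨j, hj⟩ := exists_max_rightInv i π h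
      exact ⟨j, fun _ => hj⟩
    · exact ⟨i, fun h' => absurd h' h⟩
  choose J hJ using hex
  set T : Equiv.Perm (Fin n) → Equiv.Perm (Fin n) := fun π => π * Equiv.swap i (J π) with hT
  have hTi : ∀ π, T π i = π (J π) := fun π => by simp [hT]
  have hTj : ∀ π, T π (J π) = π i := fun π => by simp [hT]
  have hTo : ∀ π x, x ≠ i → x ≠ J π → T π x = π x := fun π x h1 h2 => by
    simp [hT, Equiv.swap_apply_of_ne_of_ne h1 h2]
  have hrank : ∀ π ∈ S, rightInv i π ≤ rightInv i (T π) + 1 := by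
    intro π hπ
    obtain ⟨h1, h2, h3⟩ := hJ π (by simpa [hS] using hπ)
    unfold rightInv
    refine le_trans (Finset.card_le_card (t := insert (J π) (Finset.univ.filter
      (fun j : Fin n => i < j ∧ T π j < T π i))) ?_) (Finset.card_insert_le _ _)
    intro j hj
    simp only [Finset.mem_filter, Finset.mem_univ, true_and, Finset.mem_insert] at hj ⊢
    by_cases hjJ : j = J π
    · exact Or.inl hjJ
    · refine Or.inr ⟨hj.1, ?_⟩
      rw [hTi, hTo π j hj.1.ne' hjJ]
      exact lt_of_le_of_ne (h3 j hj.1 hj.2) (fun e => hjJ (π.injective e))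
  have hkey : ∀ π ∈ S, ∀ ρ ∈ S, T π = T ρ → ¬ T π (J π) < T π (J ρ) := by
    intro π hπ ρ hρ he hlt
    obtain ⟨h1, h2, -⟩ := hJ π (by simpa [hS] using hπ)
    obtain ⟨g1, g2, g3⟩ := hJ ρ (by simpa [hS] using hρ)
    have hne : J π ≠ J ρ := fun e => by rw [e] at hlt; exact lt_irrefl _ hlt
    have e1 : ρ (J π) = T π (J π) := by rw [he, hTo ρ _ h1.ne' hne]
    have e2 : ρ i = T π (J ρ) := by rw [he, hTj]
    have e3 : ρ (J ρ) = π (J π) := by rw [← hTi ρ, ← hTi π, he]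
    have := g3 (J π) h1 (by rw [e1, e2]; exact hlt)
    rw [e1, hTj, e3] at this
    exact absurd h2 (not_lt.mpr this)
  have hinj : Set.InjOn T S := by
    intro π hπ ρ hρ he
    have hJJ : J π = J ρ := by
      have a1 := hkey π hπ ρ hρ he
      have a2 := hkey ρ hρ π hπ he.symm
      rw [← he] at a2
      exact (T π).injective (le_antisymm (not_lt.mp a2) (not_lt.mp a1))
    simp only [hT, hJJ] at he
    exact mul_right_cancel he
  calc E = ∑ π ∈ S, mallowsPMF n q π * (rightInv i π : ℝ) := by
        rw [hE, mallowsExp, hS, Finset.sum_filter]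
        refine Finset.sum_congr rfl fun π _ => ?_
        by_cases h : rightInv i π = 0 <;> simp [h]
    _ ≤ ∑ π ∈ S, q * (mallowsPMF n q (T π) * ((rightInv i (T π) : ℝ) + 1)) := by
        refine Finset.sum_le_sum fun π hπ => ?_
        obtain ⟨h1, h2, -⟩ := hJ π (by simpa [hS] using hπ)
        rw [← mul_assoc]
        refine mul_le_mul (mallowsPMF_le_mul hq hq1.le (mallowsInv_mul_swap_lt π h1 h2))
          (by exact_mod_cast hrank π hπ) (Nat.cast_nonneg _)
          (mul_nonneg hq.le (mallowsPMF_nonneg n hq _))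
    _ = ∑ σ ∈ S.image T, q * (mallowsPMF n q σ * ((rightInv i σ : ℝ) + 1)) := by
        rw [Finset.sum_image hinj]
    _ ≤ ∑ σ, q * (mallowsPMF n q σ * ((rightInv i σ : ℝ) + 1)) := by
        refine Finset.sum_le_sum_of_subset_of_nonneg (Finset.subset_univ _) fun σ _ _ => ?_
        have := mallowsPMF_nonneg n hq σ
        positivity
    _ = q * (E + 1) := by
        simp only [← Finset.mul_sum, hE, mallowsExp, mul_add, mul_one, Finset.sum_add_distrib,
          sum_mallowsPMF n hq]

lemma mallowsExp_leftInv_eq {n : ℕ} (q : ℝ) (i : Fin n) :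
    mallowsExp n q (fun π => (leftInv i π : ℝ)) =
      mallowsExp n q (fun π => (rightInv i.rev π : ℝ)) := by
  unfold mallowsExp
  rw [← Equiv.sum_comp (revConj n) (fun π => mallowsPMF n q π * (rightInv i.rev π : ℝ))]
  refine Finset.sum_congr rfl fun π _ => ?_
  rw [rightInv_revConj, mallowsPMF, mallowsPMF, mallowsInv_revConj]

lemma mallowsExp_mono {n : ℕ} {q : ℝ} (hq : 0 < q) {f g : Equiv.Perm (Fin n) → ℝ}
    (h : ∀ π, f π ≤ g π) : mallowsExp n q f ≤ mallowsExp n q g :=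
  Finset.sum_le_sum fun π _ => mul_le_mul_of_nonneg_left (h π) (mallowsPMF_nonneg n hq π)

lemma mallowsExp_displacement_le {n : ℕ} {q : ℝ} (hq : 0 < q) (hq1 : q < 1) (i : Fin n) :
    mallowsExp n q (fun π => |((π i : ℕ) : ℝ) - ((i : ℕ) : ℝ)|) ≤
      min (2 * q / (1 - q)) ((n : ℝ) - 1) := by
  refine le_min ?_ ?_
  · calc mallowsExp n q (fun π => |((π i : ℕ) : ℝ) - ((i : ℕ) : ℝ)|)
        ≤ mallowsExp n q (fun π => (rightInv i π : ℝ) + leftInv i π) :=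
          mallowsExp_mono hq (abs_displacement_le i)
      _ = mallowsExp n q (fun π => (rightInv i π : ℝ)) +
          mallowsExp n q (fun π => (leftInv i π : ℝ)) := by
          simp only [mallowsExp, mul_add, Finset.sum_add_distrib]
      _ ≤ q / (1 - q) + q / (1 - q) := by
          rw [mallowsExp_leftInv_eq]
          exact add_le_add (mallowsExp_rightInv_le hq hq1 i) (mallowsExp_rightInv_le hq hq1 _)
      _ = 2 * q / (1 - q) := by ring
  · calc mallowsExp n q (fun π => |((π i : ℕ) : ℝ) - ((i : ℕ) : ℝ)|)
        ≤ mallowsExp n q (fun _ => (n : ℝ) - 1) := by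
          refine mallowsExp_mono hq fun π => ?_
          have h1 : ((π i : ℕ) : ℝ) + 1 ≤ n := by exact_mod_cast (π i).isLt
          have h2 : ((i : ℕ) : ℝ) + 1 ≤ n := by exact_mod_cast i.isLt
          have h3 : (0 : ℝ) ≤ ((π i : ℕ) : ℝ) := Nat.cast_nonneg _
          have h4 : (0 : ℝ) ≤ ((i : ℕ) : ℝ) := Nat.cast_nonneg _
          rw [abs_le]
          constructor <;> linarith
      _ = (n : ℝ) - 1 := by
          rw [mallowsExp, ← Finset.sum_mul, sum_mallowsPMF n hq, one_mul]

/-- A distribution on `{0, …, n-1}` whose neighbouring weights have ratio at least `q` is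
spread out around every point. -/
lemma mul_pow_le_sum_abs_sub {n r : ℕ} {q : ℝ} (hq : 0 < q) (hq1 : q ≤ 1) {p : ℕ → ℝ}
    (hp : ∀ k, 0 ≤ p k) (hsum : ∑ k ∈ Finset.range n, p k = 1)
    (hup : ∀ k, k + 1 < n → q * p k ≤ p (k + 1))
    (hdown : ∀ k, k + 1 < n → q * p (k + 1) ≤ p k) (hr : 2 * r ≤ n) (x : ℝ) :
    r * q ^ r ≤ 4 * ∑ k ∈ Finset.range n, p k * |(k : ℝ) - x| := by
  have hup' : ∀ s k, k + s < n → q ^ s * p k ≤ p (k + s) := by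
    intro s
    induction s with
    | zero => intro k _; simp
    | succ s ih =>
      intro k hk
      calc q ^ (s + 1) * p k = q * (q ^ s * p k) := by ring
        _ ≤ q * p (k + s) := mul_le_mul_of_nonneg_left (ih k (by omega)) hq.le
        _ ≤ p (k + (s + 1)) := hup (k + s) (by omega)
  have hdown' : ∀ s k, k + s < n → q ^ s * p (k + s) ≤ p k := by
    intro s
    induction s with
    | zero => intro k _; simp
    | succ s ih =>
      intro k hk
      calc q ^ (s + 1) * p (k + (s + 1)) = q ^ s * (q * p (k + s + 1)) := by
            rw [← add_assoc]; ring
        _ ≤ q ^ s * p (k + s) :=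
            mul_le_mul_of_nonneg_left (hdown (k + s) (by omega)) (pow_pos hq s).le
        _ ≤ p k := ih k (by omega)
  set f : ℕ → ℝ := fun k => p k * |(k : ℝ) - x| with hf
  have hf0 : ∀ k, 0 ≤ f k := fun k => mul_nonneg (hp k) (abs_nonneg _)
  set D := ∑ k ∈ Finset.range n, f k with hD
  obtain ⟨m, rfl⟩ : ∃ m, n = m + r := ⟨n - r, by omega⟩
  have hlow : ∀ g : ℕ → ℝ, (∀ k, 0 ≤ g k) →
      ∑ k ∈ Finset.range m, g k ≤ ∑ k ∈ Finset.range (m + r), g k := fun g hg =>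
    Finset.sum_le_sum_of_subset_of_nonneg (Finset.range_mono (by omega)) fun k _ _ => hg k
  have hhigh : ∑ k ∈ Finset.range m, f (k + r) ≤ D := by
    rw [hD, add_comm m r, Finset.sum_range_add]
    simp only [add_comm _ r]
    linarith [Finset.sum_nonneg fun k (_ : k ∈ Finset.range r) => hf0 k]
  have htri : ∀ k : ℕ, (r : ℝ) ≤ |(k : ℝ) - x| + |((k + r : ℕ) : ℝ) - x| := by
    intro k
    have h1 := neg_abs_le ((k : ℝ) - x)
    have h2 := le_abs_self (((k + r : ℕ) : ℝ) - x)
    have h3 := le_abs_self ((k : ℝ) - x)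
    push_cast at *
    linarith
  have hqr : 0 ≤ q ^ r := (pow_pos hq r).le
  have hqr1 : q ^ r ≤ 1 := pow_le_one₀ hq.le hq1
  have hA : r * q ^ r * ∑ k ∈ Finset.range m, p k ≤ 2 * D := by
    calc r * q ^ r * ∑ k ∈ Finset.range m, p k
        ≤ ∑ k ∈ Finset.range m, (f k + f (k + r)) := by
          rw [Finset.mul_sum]
          refine Finset.sum_le_sum fun k hk => ?_
          have hk' := Finset.mem_range.mp hk
          have a1 : q ^ r * p k ≤ p k := mul_le_of_le_one_left (hp k) hqr1
          calc r * q ^ r * p k = q ^ r * p k * r := by ring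
            _ ≤ q ^ r * p k * (|(k : ℝ) - x| + |((k + r : ℕ) : ℝ) - x|) :=
              mul_le_mul_of_nonneg_left (htri k) (mul_nonneg hqr (hp k))
            _ ≤ f k + f (k + r) := by
              rw [mul_add]
              exact add_le_add (mul_le_mul_of_nonneg_right a1 (abs_nonneg _))
                (mul_le_mul_of_nonneg_right (hup' r k (by omega)) (abs_nonneg _))
      _ ≤ 2 * D := by
          rw [Finset.sum_add_distrib]
          linarith [hlow f hf0]
  have hB : r * q ^ r * ∑ k ∈ Finset.range m, p (k + r) ≤ 2 * D := by
    calc r * q ^ r * ∑ k ∈ Finset.range m, p (k + r)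
        ≤ ∑ k ∈ Finset.range m, (f k + f (k + r)) := by
          rw [Finset.mul_sum]
          refine Finset.sum_le_sum fun k hk => ?_
          have hk' := Finset.mem_range.mp hk
          have a1 : q ^ r * p (k + r) ≤ p (k + r) := mul_le_of_le_one_left (hp _) hqr1
          calc r * q ^ r * p (k + r) = q ^ r * p (k + r) * r := by ring
            _ ≤ q ^ r * p (k + r) * (|(k : ℝ) - x| + |((k + r : ℕ) : ℝ) - x|) :=
              mul_le_mul_of_nonneg_left (htri k) (mul_nonneg hqr (hp _))
            _ ≤ f k + f (k + r) := by
              rw [mul_add]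
              exact add_le_add
                (mul_le_mul_of_nonneg_right (hdown' r k (by omega)) (abs_nonneg _))
                (mul_le_mul_of_nonneg_right a1 (abs_nonneg _))
      _ ≤ 2 * D := by
          rw [Finset.sum_add_distrib]
          linarith [hlow f hf0]
  have hcover : 1 ≤ ∑ k ∈ Finset.range m, p k + ∑ k ∈ Finset.range m, p (k + r) := by
    rw [← hsum, add_comm m r, Finset.sum_range_add]
    simp only [add_comm _ r]
    gcongr
    · exact fun k _ _ => hp k
    · omega
  have hrq : 0 ≤ r * q ^ r := by positivity
  nlinarith [mul_le_mul_of_nonneg_left hcover hrq]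

/-- A neighbouring value is taken at `i` with comparable probability. -/
lemma mul_sum_fiber_le {n : ℕ} {q : ℝ} (i k l : Fin n)
    (s : Equiv.Perm (Fin n)) (hs : s k = l)
    (h : ∀ π : Equiv.Perm (Fin n), q * mallowsPMF n q π ≤ mallowsPMF n q (s * π)) :
    q * ∑ π : Equiv.Perm (Fin n), (if (π i : ℕ) = k then mallowsPMF n q π else 0) ≤
      ∑ π : Equiv.Perm (Fin n), (if (π i : ℕ) = l then mallowsPMF n q π else 0) := by
  rw [← Equiv.sum_comp (Equiv.mulLeft s)
    (fun π : Equiv.Perm (Fin n) => if (π i : ℕ) = l then mallowsPMF n q π else 0), Finset.mul_sum]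
  refine Finset.sum_le_sum fun π _ => ?_
  rw [Equiv.coe_mulLeft]
  have hiff : ((s * π) i : ℕ) = l ↔ (π i : ℕ) = k := by
    rw [Equiv.Perm.mul_apply, ← hs, Fin.val_inj, Fin.val_inj, EmbeddingLike.apply_eq_iff_eq]
  by_cases hk : (π i : ℕ) = k
  · rw [if_pos hk, if_pos (hiff.mpr hk)]
    exact h π
  · rw [if_neg hk, if_neg (fun h' => hk (hiff.mp h'))]
    simp

lemma mul_pow_le_mallowsExp_displacement {n r : ℕ} {q : ℝ} (hq : 0 < q) (hq1 : q ≤ 1)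
    (i : Fin n) (hr : 2 * r ≤ n) :
    r * q ^ r ≤ 4 * mallowsExp n q (fun π => |((π i : ℕ) : ℝ) - ((i : ℕ) : ℝ)|) := by
  set p : ℕ → ℝ := fun k =>
    ∑ π : Equiv.Perm (Fin n), (if (π i : ℕ) = k then mallowsPMF n q π else 0) with hp
  have hfib : ∀ g : ℕ → ℝ, ∑ k ∈ Finset.range n, p k * g k = mallowsExp n q (fun π => g (π i)) := by
    intro g
    simp only [hp, Finset.sum_mul, mallowsExp]
    rw [Finset.sum_comm]
    refine Finset.sum_congr rfl fun π _ => ?_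
    simp [ite_mul, (π i).isLt]
  have hstep : ∀ k l : Fin n, (l : ℕ) = k + 1 → q * p k ≤ p l ∧ q * p l ≤ p k := by
    intro k l hkl
    have h := fun π : Equiv.Perm (Fin n) =>
      mul_mallowsPMF_le hq hq1 (mallowsInv_swap_mul_le π hkl)
    exact ⟨mul_sum_fiber_le i k l _ (Equiv.swap_apply_left k l) h,
      mul_sum_fiber_le i l k _ (Equiv.swap_apply_right k l) h⟩
  have hsum : ∑ k ∈ Finset.range n, p k = 1 := by
    have := hfib (fun _ => 1)
    simpa [mallowsExp, sum_mallowsPMF n hq] using this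
  have := mul_pow_le_sum_abs_sub (p := p) hq hq1
    (fun k => Finset.sum_nonneg fun π _ => by
      split_ifs
      · exact mallowsPMF_nonneg n hq π
      · exact le_rfl) hsum
    (fun k hk => (hstep ⟨k, by omega⟩ ⟨k + 1, hk⟩ rfl).1)
    (fun k hk => (hstep ⟨k, by omega⟩ ⟨k + 1, hk⟩ rfl).2) hr ((i : ℕ) : ℝ)
  rwa [hfib (fun k => |(k : ℝ) - ((i : ℕ) : ℝ)|)] at this

lemma le_mallowsExp_displacement {n : ℕ} {q : ℝ} (hn : 1 ≤ n) (hq : 0 < q) (hq1 : q < 1)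
    (i : Fin n) : 1 / 32 * min (q / (1 - q)) ((n : ℝ) - 1) ≤
      mallowsExp n q (fun π => |((π i : ℕ) : ℝ) - ((i : ℕ) : ℝ)|) := by
  have hb : ∀ r : ℕ, 2 * r ≤ n → _ := fun r hr =>
    mul_pow_le_mallowsExp_displacement (r := r) hq hq1.le i hr
  set D := mallowsExp n q (fun π => |((π i : ℕ) : ℝ) - ((i : ℕ) : ℝ)|) with hD
  set L := min (q / (1 - q)) ((n : ℝ) - 1) with hL
  have hε : 0 < 1 - q := by linarith
  rcases hn.eq_or_lt with rfl | hn2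
  · have h0 := hb 0 (by omega)
    have : L ≤ 0 := (min_le_right _ _).trans (by norm_num)
    norm_num at h0
    linarith
  have hn2' : (2 : ℝ) ≤ n := by exact_mod_cast hn2
  have hL1 : L ≤ q / (1 - q) := min_le_left _ _
  rcases lt_or_ge q (1 / 2) with hq2 | hq2
  · have h1 := hb 1 (by omega)
    have : q / (1 - q) ≤ 2 * q := by
      rw [div_le_iff₀ hε]; nlinarith
    norm_num at h1
    linarith
  · set x := min (1 / (1 - q)) (n : ℝ) / 2 with hx
    have hx1 : 1 ≤ x := by
      rw [hx, le_div_iff₀ two_pos]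
      refine le_min ?_ (by linarith)
      rw [le_div_iff₀ hε]; linarith
    have hLx : L ≤ 2 * x := by
      have : 2 * x = min (1 / (1 - q)) (n : ℝ) := by rw [hx]; ring
      rw [this]
      exact min_le_min (div_le_div_of_nonneg_right hq1.le hε.le) (by linarith)
    have hr1 : (⌊x⌋₊ : ℝ) ≤ x := Nat.floor_le (by linarith)
    have hr2 : x < ⌊x⌋₊ + 1 := Nat.lt_floor_add_one x
    have hr3 : 1 ≤ ⌊x⌋₊ := Nat.one_le_floor_iff x |>.mpr hx1
    generalize ⌊x⌋₊ = r at hr1 hr2 hr3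
    have hr3' : (1 : ℝ) ≤ r := by exact_mod_cast hr3
    have hxn : 2 * x ≤ n := by rw [hx]; linarith [min_le_right (1 / (1 - q)) (n : ℝ)]
    have hrn : 2 * r ≤ n := by
      have : (2 : ℝ) * r ≤ n := by linarith
      exact_mod_cast this
    have hrε : r * (1 - q) ≤ 1 / 2 := by
      have : (r : ℝ) ≤ 1 / (1 - q) / 2 := by
        linarith [min_le_left (1 / (1 - q)) (n : ℝ)]
      rw [div_div, le_div_iff₀ (by positivity)] at this
      linarith
    have hpow : 1 / 2 ≤ q ^ r := by
      have := one_add_mul_le_pow (a := q - 1) (by linarith) r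
      rw [add_sub_cancel] at this
      linarith
    have h1 := hb r hrn
    nlinarith [mul_le_mul_of_nonneg_left hpow (by linarith : (0 : ℝ) ≤ r)]

/-- There is an absolute constant `c>0` such that for all `0<q<1`, `n≥1`,
`1≤i≤n`, if `π ~ μ_{n,q}` then
`c·min(q/(1−q), n−1) ≤ E|π(i) − i| ≤ min(2q/(1−q), n−1)`. -/
theorem mallows_displacement_expectation :
    ∃ c : ℝ, 0 < c ∧
      ∀ (n : ℕ) (q : ℝ) (i : Fin n), 1 ≤ n → 0 < q → q < 1 →
        c * min (q / (1 - q)) ((n : ℝ) - 1) ≤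
            mallowsExp n q (fun π => |((π i : ℕ) : ℝ) - ((i : ℕ) : ℝ)|) ∧
        mallowsExp n q (fun π => |((π i : ℕ) : ℝ) - ((i : ℕ) : ℝ)|) ≤
            min (2 * q / (1 - q)) ((n : ℝ) - 1) := by
  refine ⟨1 / 32, by norm_num, fun n q i hn hq hq1 => ⟨?_, ?_⟩⟩
  · exact le_mallowsExp_displacement hn hq hq1 i
  · exact mallowsExp_displacement_le hq hq1 i
end
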